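/- Let W = (X, Y, Z, q_{Z|X,Y}) be a channel with finite alphabets, q_X, q_Y input distributions, ε > 0, β > 0 such that P((X^n,Y^n,Z^n) ∉ T1^n(ε)) ≤ exp(−nβ) and P((Y^n,Z^n) ∉ T2^n(ε)) ≤ exp(−nβ), and n large enough that exp(−nβ) ≤ 1. Then P_{C1,C2}( ||p_{Z^n|C1,C2} − q_{Z^n}|| > 7 exp(−nβ) ) ≤ 2 exp( −2 exp( n(min(R1,R2) − 2β) ) ) + |Z|^n |Y|^n exp( −(1/3) exp( −n( I(X;Z|Y) + ε + 2β − R1 ) ) ) + |Z|^n exp( −(1/3) exp( −n( I(Y;Z) + ε + 2β − R2 ) ) ). -/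

import Mathlib

open scoped BigOperators Classical

noncomputable section

namespace MACResolvability

/-- A multiple-access channel with finite input alphabets `X`, `Y`, finite output
alphabet `Z`, channel transition probabilities `W` and input distributions `qX`, `qY`. -/
structure Channel (X Y Z : Type) [Fintype X] [Fintype Y] [Fintype Z] where
  W : X → Y → Z → ℝ
  qX : X → ℝ
  qY : Y → ℝ
  W_nonneg : ∀ x y z, 0 ≤ W x y z
  W_sum_one : ∀ x y, ∑ z, W x y z = 1
  qX_nonneg : ∀ x, 0 ≤ qX x
  qX_sum_one : ∑ x, qX x = 1
  qY_nonneg : ∀ y, 0 ≤ qY y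
  qY_sum_one : ∑ y, qY y = 1

/-- Number of codewords of a codebook of block length `n` and rate `R` : `exp (n R)`. -/
def numCw (n : ℕ) (R : ℝ) : ℕ := ⌈Real.exp ((n : ℝ) * R)⌉₊

/-- Variational distance between two (mass) functions on a finite set. -/
def tvDist {α : Type} [Fintype α] (p q : α → ℝ) : ℝ := (1 / 2) * ∑ a, |p a - q a|

/-- The standard normal cumulative distribution function `Φ`. -/
def stdNormalCDF (a : ℝ) : ℝ :=
  ∫ x in Set.Iic a, Real.exp (-(x ^ 2) / 2) / Real.sqrt (2 * Real.pi)

/-- The Gaussian tail function `Q = 1 - Φ`. -/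
def Qfun (a : ℝ) : ℝ := 1 - stdNormalCDF a

/-- The inverse of the Gaussian tail function `Q` on `(0,1)`. -/
def Qinv (e : ℝ) : ℝ := Function.invFun Qfun e

variable {X Y Z : Type} [Fintype X] [Fintype Y] [Fintype Z]

namespace Channel

variable (P : Channel X Y Z)

/-- Induced joint distribution `q_{X,Y,Z}`. -/
def joint (x : X) (y : Y) (z : Z) : ℝ := P.qX x * P.qY y * P.W x y z

/-- Output distribution `q_Z`. -/
def qZ (z : Z) : ℝ := ∑ x, ∑ y, P.joint x y z

/-- Conditional output distribution `q_{Z|Y}`. -/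
def qZgY (y : Y) (z : Z) : ℝ := ∑ x, P.qX x * P.W x y z

/-- Conditional output distribution `q_{Z|X}`. -/
def qZgX (x : X) (z : Z) : ℝ := ∑ y, P.qY y * P.W x y z

/-- Conditional information density `i(x; z | y)`. -/
def iXZgY (x : X) (y : Y) (z : Z) : ℝ := Real.log (P.W x y z / P.qZgY y z)

/-- Information density `i(y; z)`. -/
def iYZ (y : Y) (z : Z) : ℝ := Real.log (P.qZgY y z / P.qZ z)

/-- Information density `i(x; z)`. -/
def iXZ (x : X) (z : Z) : ℝ := Real.log (P.qZgX x z / P.qZ z)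

/-- Conditional information density `i(y; z | x)`. -/
def iYZgX (x : X) (y : Y) (z : Z) : ℝ := Real.log (P.W x y z / P.qZgX x z)

/-- Conditional mutual information `I(X; Z | Y)`. -/
def IXZgY : ℝ := ∑ x, ∑ y, ∑ z, P.joint x y z * P.iXZgY x y z

/-- Mutual information `I(Y; Z)`. -/
def IYZ : ℝ := ∑ x, ∑ y, ∑ z, P.joint x y z * P.iYZ y z

/-- Mutual information `I(X; Z)`. -/
def IXZ : ℝ := ∑ x, ∑ y, ∑ z, P.joint x y z * P.iXZ x z

/-- Conditional mutual information `I(Y; Z | X)`. -/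
def IYZgX : ℝ := ∑ x, ∑ y, ∑ z, P.joint x y z * P.iYZgX x y z

/-- Central second moment of a per-letter function of `(X,Y,Z)` under the joint. -/
def centralMoment2 (f : X → Y → Z → ℝ) : ℝ :=
  ∑ x, ∑ y, ∑ z, P.joint x y z *
    (f x y z - ∑ x', ∑ y', ∑ z', P.joint x' y' z' * f x' y' z') ^ 2

/-- Central absolute third moment of a per-letter function of `(X,Y,Z)` under the joint. -/
def absMoment3 (f : X → Y → Z → ℝ) : ℝ :=
  ∑ x, ∑ y, ∑ z, P.joint x y z *
    |f x y z - ∑ x', ∑ y', ∑ z', P.joint x' y' z' * f x' y' z'| ^ 3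

/-- Central second moment of `i(X;Z|Y)`. -/
def V1 : ℝ := P.centralMoment2 P.iXZgY
/-- Central absolute third moment of `i(X;Z|Y)`. -/
def Tm1 : ℝ := P.absMoment3 P.iXZgY
/-- Central second moment of `i(Y;Z)`. -/
def V2 : ℝ := P.centralMoment2 fun _ y z => P.iYZ y z
/-- Central absolute third moment of `i(Y;Z)`. -/
def Tm2 : ℝ := P.absMoment3 fun _ y z => P.iYZ y z
/-- Central second moment of `i(X;Z)`. -/
def VX : ℝ := P.centralMoment2 fun x _ z => P.iXZ x z
/-- Central absolute third moment of `i(X;Z)`. -/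
def TmX : ℝ := P.absMoment3 fun x _ z => P.iXZ x z
/-- Central second moment of `i(Y;Z|X)`. -/
def VYgX : ℝ := P.centralMoment2 P.iYZgX
/-- Central absolute third moment of `i(Y;Z|X)`. -/
def TmYgX : ℝ := P.absMoment3 P.iYZgX

/-- `n`-fold product channel `q_{Z^n | X^n, Y^n}`. -/
def Wn (n : ℕ) (xs : Fin n → X) (ys : Fin n → Y) (zs : Fin n → Z) : ℝ :=
  ∏ k, P.W (xs k) (ys k) (zs k)

/-- `n`-fold product output distribution `q_{Z^n}`. -/
def qZn (n : ℕ) (zs : Fin n → Z) : ℝ := ∏ k, P.qZ (zs k)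

/-- `n`-fold product conditional distribution `q_{Z^n | Y^n}`. -/
def qZgYn (n : ℕ) (ys : Fin n → Y) (zs : Fin n → Z) : ℝ := ∏ k, P.qZgY (ys k) (zs k)

/-- `n`-letter conditional information density `i(x^n; z^n | y^n)`. -/
def iXZgYn (n : ℕ) (xs : Fin n → X) (ys : Fin n → Y) (zs : Fin n → Z) : ℝ :=
  ∑ k, P.iXZgY (xs k) (ys k) (zs k)

/-- `n`-letter information density `i(y^n; z^n)`. -/
def iYZn (n : ℕ) (ys : Fin n → Y) (zs : Fin n → Z) : ℝ := ∑ k, P.iYZ (ys k) (zs k)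

/-- The typical set `T1^n(ε)`. -/
def T1set (n : ℕ) (ε : ℝ) : Set ((Fin n → X) × (Fin n → Y) × (Fin n → Z)) :=
  {t | P.iXZgYn n t.1 t.2.1 t.2.2 ≤ (n : ℝ) * (P.IXZgY + ε)}

/-- The typical set `T2^n(ε)`. -/
def T2set (n : ℕ) (ε : ℝ) : Set ((Fin n → Y) × (Fin n → Z)) :=
  {t | P.iYZn n t.1 t.2 ≤ (n : ℝ) * (P.IYZ + ε)}

/-- Probability of an event under the `n`-fold i.i.d. joint distribution `q_{X,Y,Z}^n`. -/
def jointPn (n : ℕ) (A : Set ((Fin n → X) × (Fin n → Y) × (Fin n → Z))) : ℝ :=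
  ∑ xs : Fin n → X, ∑ ys : Fin n → Y, ∑ zs : Fin n → Z,
    (∏ k, P.joint (xs k) (ys k) (zs k)) * (if (xs, ys, zs) ∈ A then 1 else 0)

/-- Probability of an event of `(Y^n, Z^n)` under the `n`-fold i.i.d. joint distribution. -/
def jointPYZn (n : ℕ) (A : Set ((Fin n → Y) × (Fin n → Z))) : ℝ :=
  ∑ xs : Fin n → X, ∑ ys : Fin n → Y, ∑ zs : Fin n → Z,
    (∏ k, P.joint (xs k) (ys k) (zs k)) * (if (ys, zs) ∈ A then 1 else 0)

/-- Probability of an event of the pair of random codebooks, each component of each codeword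
drawn i.i.d. according to `qX` resp. `qY`. -/
def cbP2 (n M1 M2 : ℕ)
    (E : (Fin M1 → Fin n → X) → (Fin M2 → Fin n → Y) → Prop) : ℝ :=
  ∑ C1 : Fin M1 → Fin n → X, ∑ C2 : Fin M2 → Fin n → Y,
    ((∏ m, ∏ k, P.qX (C1 m k)) * (∏ m, ∏ k, P.qY (C2 m k))) *
      (if E C1 C2 then 1 else 0)

/-- Probability of an event of the random codebook `C1`. -/
def cbP1 (n M1 : ℕ) (E : (Fin M1 → Fin n → X) → Prop) : ℝ :=
  ∑ C1 : Fin M1 → Fin n → X,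
    (∏ m, ∏ k, P.qX (C1 m k)) * (if E C1 then 1 else 0)

/-- Expectation of a function of the pair of random codebooks. -/
def cbE2 (n M1 M2 : ℕ)
    (f : (Fin M1 → Fin n → X) → (Fin M2 → Fin n → Y) → ℝ) : ℝ :=
  ∑ C1 : Fin M1 → Fin n → X, ∑ C2 : Fin M2 → Fin n → Y,
    ((∏ m, ∏ k, P.qX (C1 m k)) * (∏ m, ∏ k, P.qY (C2 m k))) * f C1 C2

/-- The output distribution `p_{Z^n | C1, C2}` induced by the codebooks `C1`, `C2`. -/
def pOut (n : ℕ) (R1 R2 : ℝ) {M1 M2 : ℕ}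
    (C1 : Fin M1 → Fin n → X) (C2 : Fin M2 → Fin n → Y) (zs : Fin n → Z) : ℝ :=
  Real.exp (-((n : ℝ) * (R1 + R2))) * ∑ m1, ∑ m2, P.Wn n (C1 m1) (C2 m2) zs

/-- The atypical term `P_atyp,1` for a typical set `T1`. -/
def Patyp1 (n : ℕ) (R1 R2 : ℝ) {M1 M2 : ℕ}
    (C1 : Fin M1 → Fin n → X) (C2 : Fin M2 → Fin n → Y)
    (T1 : Set ((Fin n → X) × (Fin n → Y) × (Fin n → Z))) : ℝ :=
  ∑ zs : Fin n → Z, Real.exp (-((n : ℝ) * (R1 + R2))) *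
    ∑ m1, ∑ m2, P.Wn n (C1 m1) (C2 m2) zs *
      (if (C1 m1, C2 m2, zs) ∈ T1 then 0 else 1)

/-- The atypical term `P_atyp,2` for a typical set `T2`. -/
def Patyp2 (n : ℕ) (R1 R2 : ℝ) {M1 M2 : ℕ}
    (C1 : Fin M1 → Fin n → X) (C2 : Fin M2 → Fin n → Y)
    (T2 : Set ((Fin n → Y) × (Fin n → Z))) : ℝ :=
  ∑ zs : Fin n → Z, Real.exp (-((n : ℝ) * (R1 + R2))) *
    ∑ m1, ∑ m2, P.Wn n (C1 m1) (C2 m2) zs *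
      (if (C2 m2, zs) ∈ T2 then 0 else 1)

/-- The typical term `T_typ(z^n)`. -/
def Ttyp (n : ℕ) (R1 R2 : ℝ) {M1 M2 : ℕ}
    (C1 : Fin M1 → Fin n → X) (C2 : Fin M2 → Fin n → Y)
    (T1 : Set ((Fin n → X) × (Fin n → Y) × (Fin n → Z)))
    (T2 : Set ((Fin n → Y) × (Fin n → Z))) (zs : Fin n → Z) : ℝ :=
  ∑ m1, ∑ m2, Real.exp (-((n : ℝ) * (R1 + R2))) *
    (P.Wn n (C1 m1) (C2 m2) zs / P.qZn n zs) *
    (if (C2 m2, zs) ∈ T2 then 1 else 0) *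
    (if (C1 m1, C2 m2, zs) ∈ T1 then 1 else 0)

/-- The typical term `T_typ,1(y^n, z^n)` of the first codebook. -/
def Ttyp1 (n : ℕ) (R1 : ℝ) {M1 : ℕ} (C1 : Fin M1 → Fin n → X)
    (ys : Fin n → Y) (zs : Fin n → Z)
    (T1 : Set ((Fin n → X) × (Fin n → Y) × (Fin n → Z))) : ℝ :=
  ∑ m1, Real.exp (-((n : ℝ) * R1)) *
    (P.Wn n (C1 m1) ys zs / P.qZgYn n ys zs) *
    (if (C1 m1, ys, zs) ∈ T1 then 1 else 0)

end Channel

theorem exp_chord (s K g : ℝ) (hK : 0 < K) (h0 : 0 ≤ g) (h1 : g ≤ K) :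
    Real.exp (s * g) ≤ 1 + g * ((Real.exp (s * K) - 1) / K) := by
  have hb : g / K ≤ 1 := (div_le_one hK).2 h1
  have h := convexOn_exp.2 (Set.mem_univ (0:ℝ)) (Set.mem_univ (s * K))
    (show (0:ℝ) ≤ 1 - g / K by linarith) (show 0 ≤ g / K by positivity) (by ring)
  simp only [smul_eq_mul, mul_zero, zero_add, Real.exp_zero, mul_one] at h
  have e : g / K * (s * K) = s * g := by field_simp
  rw [e] at h
  calc _ ≤ _ := h
    _ = _ := by ring

theorem mgf_bound {Ω : Type} [Fintype Ω] (w f : Ω → ℝ) (hw0 : ∀ a, 0 ≤ w a)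
    (hw1 : ∑ a, w a = 1) (s K μ : ℝ) (hs : 0 ≤ s) (hK : 0 < K) (hf0 : ∀ a, 0 ≤ f a)
    (hfK : ∀ a, 0 < w a → f a ≤ K) (hE : ∑ a, w a * f a ≤ μ) :
    ∑ a, w a * Real.exp (s * f a) ≤ Real.exp (μ * ((Real.exp (s * K) - 1) / K)) := by
  have hc : 0 ≤ (Real.exp (s * K) - 1) / K := by
    have : 1 ≤ Real.exp (s * K) := Real.one_le_exp (by positivity)
    apply div_nonneg _ hK.le
    linarith
  set c := (Real.exp (s * K) - 1) / K with hcdef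
  calc ∑ a, w a * Real.exp (s * f a) ≤ ∑ a, (w a + w a * f a * c) := by
        apply Finset.sum_le_sum
        intro a _
        rcases (hw0 a).eq_or_lt with h | h
        · simp [← h]
        · have := exp_chord s K (f a) hK (hf0 a) (hfK a h)
          calc _ ≤ w a * (1 + f a * c) := mul_le_mul_of_nonneg_left this h.le
            _ = _ := by ring
    _ = 1 + (∑ a, w a * f a) * c := by
        rw [Finset.sum_add_distrib, hw1, Finset.sum_mul]
    _ ≤ μ * c + 1 := by nlinarith
    _ ≤ _ := Real.add_one_le_exp _

theorem chernoff {Ω : Type} [Fintype Ω] (w f : Ω → ℝ) (hw0 : ∀ a, 0 ≤ w a)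
    (hw1 : ∑ a, w a = 1) (K μ δ : ℝ) (hμ : 0 ≤ μ) (hK : 0 < K) (hδ0 : 0 ≤ δ) (hδ1 : δ ≤ 1)
    (hf0 : ∀ a, 0 ≤ f a)
    (hfK : ∀ a, 0 < w a → f a ≤ μ * K) (hE : ∑ a, w a * f a ≤ μ) (M : ℕ) :
    ∑ C : Fin M → Ω, (∏ m, w (C m)) *
      (if ∑ m, f (C m) > (M : ℝ) * ((1 + δ) * μ) then 1 else 0)
      ≤ Real.exp (-((M : ℝ) * δ ^ 2 / (3 * K))) := by
  rcases hμ.eq_or_lt with h | hμ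
  · subst h
    refine le_trans (le_of_eq ?_) (Real.exp_pos _).le
    apply Finset.sum_eq_zero
    intro C _
    by_cases hC : ∃ m, w (C m) = 0
    · obtain ⟨m, hm⟩ := hC
      rw [Finset.prod_eq_zero (Finset.mem_univ m) hm, zero_mul]
    · push Not at hC
      have : ∑ m, f (C m) = 0 := Finset.sum_eq_zero fun m _ => by
        have := hfK _ (lt_of_le_of_ne (hw0 (C m)) (hC m).symm)
        have := hf0 (C m)
        linarith
      simp [this]
  · set s := Real.log (1 + δ) / K with hs
    have hl0 : 0 ≤ Real.log (1 + δ) := Real.log_nonneg (by linarith)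
    have hs0 : 0 ≤ s := by positivity
    have hm := mgf_bound w (fun a => f a / μ) hw0 hw1 s K 1 hs0 hK
      (fun a => div_nonneg (hf0 a) hμ.le)
      (fun a ha => by rw [div_le_iff₀ hμ]; linarith [hfK a ha])
      (by
        simp_rw [← mul_div_assoc]
        rw [← Finset.sum_div]
        exact (div_le_one hμ).2 hE)
    have hsK : s * K = Real.log (1 + δ) := by rw [hs]; field_simp
    rw [hsK, Real.exp_log (by linarith)] at hm
    set A := ∑ a, w a * Real.exp (s * (f a / μ)) with hA
    have hA0 : 0 ≤ A := Finset.sum_nonneg fun a _ => mul_nonneg (hw0 a) (Real.exp_pos _).le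
    calc _ ≤ ∑ C : Fin M → Ω, (∏ m, w (C m) * Real.exp (s * (f (C m) / μ))) *
            Real.exp (-(s * (M * (1 + δ)))) := by
          apply Finset.sum_le_sum
          intro C _
          rw [Finset.prod_mul_distrib, mul_assoc]
          apply mul_le_mul_of_nonneg_left _ (Finset.prod_nonneg fun m _ => hw0 _)
          rw [← Real.exp_sum, ← Real.exp_add]
          split_ifs with hif
          · apply Real.one_le_exp
            rw [← Finset.mul_sum, ← Finset.sum_div]
            have : (M : ℝ) * (1 + δ) ≤ (∑ i, f (C i)) / μ := by
              rw [le_div_iff₀ hμ]; linarith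
            nlinarith
          · exact (Real.exp_pos _).le
      _ = A ^ M * Real.exp (-(s * (M * (1 + δ)))) := by
          rw [← Finset.sum_mul]
          congr 1
          rw [hA, Fintype.sum_pow]
      _ ≤ (Real.exp (1 * ((1 + δ - 1) / K))) ^ M * Real.exp (-(s * (M * (1 + δ)))) := by
          gcongr
      _ ≤ _ := by
          rw [← Real.exp_nat_mul, ← Real.exp_add]
          apply Real.exp_le_exp.2
          have hlog := Real.le_log_one_add_of_nonneg hδ0
          have key : δ ^ 2 / 3 ≤ (1 + δ) * Real.log (1 + δ) - δ := by
            have h2 : (1 + δ) * (2 * δ / (δ + 2)) ≤ (1 + δ) * Real.log (1 + δ) := by gcongr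
            have h3 : (1 + δ) * (2 * δ / (δ + 2)) - δ = δ ^ 2 / (δ + 2) := by
              field_simp; ring
            have h4 : δ ^ 2 / 3 ≤ δ ^ 2 / (δ + 2) := by gcongr; linarith
            linarith
          have e1 : (M : ℝ) * (1 * ((1 + δ - 1) / K)) + -(s * (M * (1 + δ)))
              = -(M / K * ((1 + δ) * Real.log (1 + δ) - δ)) := by
            rw [hs]; field_simp; ring
          have e2 : (M : ℝ) * δ ^ 2 / (3 * K) = M / K * (δ ^ 2 / 3) := by field_simp
          rw [e1, e2]
          apply neg_le_neg
          gcongr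

theorem sum_inj {Ω Λ : Type} [Fintype Ω] [Fintype Λ] (w : Ω → ℝ) (v : Λ → ℝ)
    (hv1 : ∑ b, v b = 1) (G : Ω → Λ → ℝ) (M1 M2 : ℕ) (σ : Fin M1 → Fin M2)
    (hσ : Function.Injective σ) :
    ∑ C1 : Fin M1 → Ω, ∑ C2 : Fin M2 → Λ, ((∏ m, w (C1 m)) * (∏ m, v (C2 m))) *
      ∏ i, G (C1 i) (C2 (σ i)) = (∑ a, ∑ b, w a * v b * G a b) ^ M1 := by
  have key : ∀ C1 : Fin M1 → Ω, ∑ C2 : Fin M2 → Λ, (∏ m, v (C2 m)) *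
      ∏ i, G (C1 i) (C2 (σ i)) = ∏ i, ∑ b, v b * G (C1 i) b := by
    intro C1
    have h1 : ∀ C2 : Fin M2 → Λ, (∏ m, v (C2 m)) * ∏ i, G (C1 i) (C2 (σ i))
        = ∏ j, (v (C2 j) * ∏ i with σ i = j, G (C1 i) (C2 j)) := by
      intro C2
      rw [Finset.prod_mul_distrib]
      congr 1
      rw [← Finset.prod_fiberwise Finset.univ σ]
      apply Finset.prod_congr rfl
      intro j _
      apply Finset.prod_congr rfl
      intro i hi
      rw [(Finset.mem_filter.1 hi).2]
    simp_rw [h1]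
    rw [← Fintype.piFinset_univ, ← Finset.prod_univ_sum (fun _ => Finset.univ)
      (fun j b => v b * ∏ i with σ i = j, G (C1 i) b)]
    rw [← Finset.prod_fiberwise Finset.univ σ]
    apply Finset.prod_congr rfl
    intro j _
    by_cases hj : ∃ i, σ i = j
    · obtain ⟨i, rfl⟩ := hj
      have : (Finset.univ.filter fun i' => σ i' = σ i) = {i} := by
        ext i'; simp [hσ.eq_iff]
      simp [this]
    · have : (Finset.univ.filter fun i' => σ i' = j) = ∅ := by
        ext i'; simpa using fun h => hj ⟨i', h⟩
      simp [this, hv1]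
  simp_rw [mul_assoc, ← Finset.mul_sum]
  simp_rw [key, ← Finset.prod_mul_distrib]
  rw [Fintype.sum_pow]

theorem ustat {Ω Λ : Type} [Fintype Ω] [Fintype Λ] (w : Ω → ℝ) (v : Λ → ℝ)
    (hw0 : ∀ a, 0 ≤ w a) (hv0 : ∀ b, 0 ≤ v b) (hw1 : ∑ a, w a = 1)
    (hv1 : ∑ b, v b = 1) (h : Ω → Λ → ℝ) (h0 : ∀ a b, 0 ≤ h a b) (h1 : ∀ a b, h a b ≤ 1)
    (δ : ℝ) (hδ : 0 ≤ δ)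
    (hE : ∑ a, ∑ b, w a * v b * h a b ≤ δ) (M1 M2 : ℕ) (hM : M1 ≤ M2) (hM2 : 0 < M2) :
    ∑ C1 : Fin M1 → Ω, ∑ C2 : Fin M2 → Λ, ((∏ m, w (C1 m)) * (∏ m, v (C2 m))) *
      (if ∑ i, ∑ j, h (C1 i) (C2 j) > 2 * δ * (M1 * M2) then 1 else 0)
      ≤ Real.exp (-(M1 * δ / 3)) := by
  have : NeZero M2 := ⟨hM2.ne'⟩
  have hM2' : (0:ℝ) < M2 := by exact_mod_cast hM2
  have hlog0 : 0 < Real.log 2 := Real.log_pos (by norm_num)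
  set t := Real.log 2 with ht
  set σ : Fin M2 → Fin M1 → Fin M2 := fun s i => Fin.castLE hM i + s with hσdef
  have hσ : ∀ s, Function.Injective (σ s) := by
    intro s i j hij
    exact Fin.castLE_injective hM (add_right_cancel hij)
  have hsum : ∀ (C1 : Fin M1 → Ω) (C2 : Fin M2 → Λ),
      ∑ i, ∑ j, h (C1 i) (C2 j) = ∑ s, ∑ i, h (C1 i) (C2 (σ s i)) := by
    intro C1 C2
    rw [Finset.sum_comm (s := Finset.univ (α := Fin M2))]
    apply Finset.sum_congr rfl
    intro i _
    exact (Equiv.sum_comp (Equiv.addLeft (Fin.castLE hM i)) (fun j => h (C1 i) (C2 j))).symm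
  have hmg : ∑ a, ∑ b, w a * v b * Real.exp (t * h a b) ≤ Real.exp δ := by
    have := mgf_bound (Ω := Ω × Λ) (fun p => w p.1 * v p.2) (fun p => h p.1 p.2)
      (fun p => mul_nonneg (hw0 _) (hv0 _))
      (by
        rw [Fintype.sum_prod_type]
        simp_rw [← Finset.mul_sum, hv1, mul_one, hw1])
      t 1 δ hlog0.le one_pos (fun p => h0 _ _) (fun p _ => h1 _ _)
      (by rw [Fintype.sum_prod_type]; exact hE)
    rw [Fintype.sum_prod_type] at this
    rw [mul_one, ht, Real.exp_log (by norm_num)] at this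
    norm_num at this
    exact this
  have hjen : ∀ (C1 : Fin M1 → Ω) (C2 : Fin M2 → Λ),
      (if ∑ i, ∑ j, h (C1 i) (C2 j) > 2 * δ * (M1 * M2) then (1:ℝ) else 0) ≤
      ∑ s : Fin M2, (1 / (M2:ℝ)) * (Real.exp (-(t * (2 * δ * M1))) *
        ∏ i, Real.exp (t * h (C1 i) (C2 (σ s i)))) := by
    intro C1 C2
    split_ifs with hif
    · rw [hsum] at hif
      have hj := convexOn_exp.map_sum_le (t := Finset.univ (α := Fin M2))
        (w := fun _ => 1 / (M2 : ℝ))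
        (p := fun s => -(t * (2 * δ * M1)) + ∑ i, t * h (C1 i) (C2 (σ s i)))
        (fun _ _ => by positivity) (by simp [hM2'.ne']) (fun _ _ => Set.mem_univ _)
      simp only [smul_eq_mul] at hj
      have hone : 1 ≤ Real.exp (∑ s : Fin M2, (1 / (M2:ℝ)) *
          (-(t * (2 * δ * M1)) + ∑ i, t * h (C1 i) (C2 (σ s i)))) := by
        apply Real.one_le_exp
        rw [← Finset.mul_sum, Finset.sum_add_distrib]
        simp_rw [← Finset.mul_sum]
        simp only [Finset.sum_const, Finset.card_univ, Fintype.card_fin, nsmul_eq_mul]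
        apply mul_nonneg (by positivity)
        nlinarith
      refine (hone.trans hj).trans (le_of_eq ?_)
      apply Finset.sum_congr rfl
      intro s _
      rw [Real.exp_add, Real.exp_sum]
    · positivity
  calc _ ≤ ∑ C1 : Fin M1 → Ω, ∑ C2 : Fin M2 → Λ, ((∏ m, w (C1 m)) * (∏ m, v (C2 m))) *
      ∑ s : Fin M2, (1 / (M2:ℝ)) * (Real.exp (-(t * (2 * δ * M1))) *
        ∏ i, Real.exp (t * h (C1 i) (C2 (σ s i)))) := by
        apply Finset.sum_le_sum; intro C1 _
        apply Finset.sum_le_sum; intro C2 _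
        exact mul_le_mul_of_nonneg_left (hjen C1 C2)
          (mul_nonneg (Finset.prod_nonneg fun _ _ => hw0 _) (Finset.prod_nonneg fun _ _ => hv0 _))
    _ = ∑ s : Fin M2, (1 / (M2:ℝ)) * (Real.exp (-(t * (2 * δ * M1))) *
        ∑ C1 : Fin M1 → Ω, ∑ C2 : Fin M2 → Λ, ((∏ m, w (C1 m)) * (∏ m, v (C2 m))) *
          ∏ i, Real.exp (t * h (C1 i) (C2 (σ s i)))) := by
        simp_rw [Finset.mul_sum]
        symm
        rw [Finset.sum_comm]
        apply Finset.sum_congr rfl; intro C1 _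
        rw [Finset.sum_comm]
        apply Finset.sum_congr rfl; intro C2 _
        apply Finset.sum_congr rfl; intro s _
        ring
    _ = Real.exp (-(t * (2 * δ * M1))) * (∑ a, ∑ b, w a * v b * Real.exp (t * h a b)) ^ M1 := by
        simp_rw [fun s => sum_inj w v hv1 (fun a b => Real.exp (t * h a b)) M1 M2 (σ s) (hσ s)]
        simp only [Finset.sum_const, Finset.card_univ, Fintype.card_fin, nsmul_eq_mul]
        field_simp
    _ ≤ Real.exp (-(t * (2 * δ * M1))) * (Real.exp δ) ^ M1 := by
        gcongr
        exact Finset.sum_nonneg fun a _ => Finset.sum_nonneg fun b _ =>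
          mul_nonneg (mul_nonneg (hw0 _) (hv0 _)) (Real.exp_pos _).le
    _ ≤ _ := by
        rw [← Real.exp_nat_mul, ← Real.exp_add]
        apply Real.exp_le_exp.2
        have : (0.6931471803:ℝ) < t := Real.log_two_gt_d9
        have hp : 0 ≤ (M1:ℝ) * δ := by positivity
        nlinarith

theorem union_bound {A B ι κ : Type} [Fintype A] [Fintype B] [Fintype ι] [Fintype κ]
    (w : A → ℝ) (v : B → ℝ) (hw0 : ∀ a, 0 ≤ w a) (hv0 : ∀ b, 0 ≤ v b)
    (hw1 : ∑ a, w a = 1) (hv1 : ∑ b, v b = 1) (E a1 a2 : A → B → ℝ)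
    (b1 : ι → A → ℝ) (b2 : κ → B → ℝ)
    (hE : ∀ a b, E a b ≤ a1 a b + a2 a b + ∑ i, b1 i a + ∑ k, b2 k b) (c0 c1 c2 : ℝ)
    (h01 : ∑ a, ∑ b, (w a * v b) * a1 a b ≤ c0)
    (h02 : ∑ a, ∑ b, (w a * v b) * a2 a b ≤ c0)
    (h1 : ∀ i, ∑ a, w a * b1 i a ≤ c1)
    (h2 : ∀ k, ∑ b, v b * b2 k b ≤ c2) :
    ∑ a, ∑ b, (w a * v b) * E a b ≤
      2 * c0 + (Fintype.card ι : ℝ) * c1 + (Fintype.card κ : ℝ) * c2 := by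
  have e1 : ∑ a, ∑ b, (w a * v b) * ∑ i, b1 i a = ∑ i, ∑ a, w a * b1 i a := by
    rw [Finset.sum_comm (s := Finset.univ (α := ι))]
    apply Finset.sum_congr rfl; intro a _
    rw [← Finset.sum_mul, ← Finset.mul_sum, hv1, mul_one, Finset.mul_sum]
  have e2 : ∑ a, ∑ b, (w a * v b) * ∑ k, b2 k b = ∑ k, ∑ b, v b * b2 k b := by
    rw [Finset.sum_comm, Finset.sum_comm (s := Finset.univ (α := κ))]
    apply Finset.sum_congr rfl; intro b _
    rw [← Finset.sum_mul, ← Finset.sum_mul, hw1, one_mul, Finset.mul_sum]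
  calc _ ≤ ∑ a, ∑ b, (w a * v b) * (a1 a b + a2 a b + ∑ i, b1 i a + ∑ k, b2 k b) := by
        apply Finset.sum_le_sum; intro a _
        apply Finset.sum_le_sum; intro b _
        exact mul_le_mul_of_nonneg_left (hE a b) (mul_nonneg (hw0 _) (hv0 _))
    _ = ∑ a, ∑ b, (w a * v b) * a1 a b + ∑ a, ∑ b, (w a * v b) * a2 a b
        + ∑ i, ∑ a, w a * b1 i a + ∑ k, ∑ b, v b * b2 k b := by
        rw [← e1, ← e2]
        simp_rw [mul_add, Finset.sum_add_distrib]
    _ ≤ c0 + c0 + ∑ i : ι, c1 + ∑ k : κ, c2 := by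
        gcongr with i _ k _
        · exact h1 i
        · exact h2 k
    _ = _ := by simp; ring

theorem sum_prod_pi {α : Type} [Fintype α] (n : ℕ) (f : Fin n → α → ℝ) :
    ∑ p : Fin n → α, ∏ k, f k (p k) = ∏ k, ∑ a, f k a := by
  rw [Finset.prod_univ_sum, Fintype.piFinset_univ]

namespace Channel

variable (P : Channel X Y Z)

theorem qZgY_nonneg (y : Y) (z : Z) : 0 ≤ P.qZgY y z :=
  Finset.sum_nonneg fun x _ => mul_nonneg (P.qX_nonneg x) (P.W_nonneg x y z)

theorem qZ_eq (z : Z) : P.qZ z = ∑ y, P.qY y * P.qZgY y z := by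
  unfold qZ qZgY joint
  rw [Finset.sum_comm]
  apply Finset.sum_congr rfl; intro y _
  rw [Finset.mul_sum]
  apply Finset.sum_congr rfl; intro x _
  ring

theorem qZ_nonneg (z : Z) : 0 ≤ P.qZ z := by
  rw [qZ_eq]
  exact Finset.sum_nonneg fun y _ => mul_nonneg (P.qY_nonneg y) (P.qZgY_nonneg y z)

theorem qZgY_sum (y : Y) : ∑ z, P.qZgY y z = 1 := by
  unfold qZgY
  rw [Finset.sum_comm]
  simp_rw [← Finset.mul_sum, P.W_sum_one, mul_one, P.qX_sum_one]

theorem qZ_sum : ∑ z, P.qZ z = 1 := by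
  simp_rw [qZ_eq]
  rw [Finset.sum_comm]
  simp_rw [← Finset.mul_sum, P.qZgY_sum, mul_one, P.qY_sum_one]

/-- product input weight -/
def wX (n : ℕ) (xs : Fin n → X) : ℝ := ∏ k, P.qX (xs k)
/-- product input weight -/
def wY (n : ℕ) (ys : Fin n → Y) : ℝ := ∏ k, P.qY (ys k)

theorem wX_nonneg (n : ℕ) (xs : Fin n → X) : 0 ≤ P.wX n xs :=
  Finset.prod_nonneg fun _ _ => P.qX_nonneg _
theorem wY_nonneg (n : ℕ) (xs : Fin n → Y) : 0 ≤ P.wY n xs :=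
  Finset.prod_nonneg fun _ _ => P.qY_nonneg _
theorem wX_sum (n : ℕ) : ∑ xs, P.wX n xs = 1 := by
  unfold wX
  rw [sum_prod_pi n (fun _ x => P.qX x)]; simp [P.qX_sum_one]
theorem wY_sum (n : ℕ) : ∑ xs, P.wY n xs = 1 := by
  unfold wY
  rw [sum_prod_pi n (fun _ x => P.qY x)]; simp [P.qY_sum_one]
theorem Wn_nonneg (n : ℕ) (xs : Fin n → X) (ys : Fin n → Y) (zs : Fin n → Z) :
    0 ≤ P.Wn n xs ys zs := Finset.prod_nonneg fun _ _ => P.W_nonneg _ _ _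
theorem Wn_sum (n : ℕ) (xs : Fin n → X) (ys : Fin n → Y) : ∑ zs, P.Wn n xs ys zs = 1 := by
  unfold Wn
  rw [sum_prod_pi n (fun k z => P.W (xs k) (ys k) z)]; simp [P.W_sum_one]
theorem qZn_nonneg (n : ℕ) (zs : Fin n → Z) : 0 ≤ P.qZn n zs :=
  Finset.prod_nonneg fun _ _ => P.qZ_nonneg _
theorem qZn_sum (n : ℕ) : ∑ zs, P.qZn n zs = 1 := by
  unfold qZn
  rw [sum_prod_pi n (fun _ x => P.qZ x)]; simp [P.qZ_sum]
theorem qZgYn_nonneg (n : ℕ) (ys : Fin n → Y) (zs : Fin n → Z) : 0 ≤ P.qZgYn n ys zs :=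
  Finset.prod_nonneg fun _ _ => P.qZgY_nonneg _ _
theorem wX_Wn (n : ℕ) (ys : Fin n → Y) (zs : Fin n → Z) :
    ∑ xs, P.wX n xs * P.Wn n xs ys zs = P.qZgYn n ys zs := by
  unfold wX Wn qZgYn qZgY
  simp_rw [← Finset.prod_mul_distrib]
  rw [sum_prod_pi n (fun k x => P.qX x * P.W x (ys k) (zs k))]
theorem wY_qZgYn (n : ℕ) (zs : Fin n → Z) :
    ∑ ys, P.wY n ys * P.qZgYn n ys zs = P.qZn n zs := by
  unfold wY qZgYn qZn
  simp_rw [← Finset.prod_mul_distrib, qZ_eq]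
  rw [sum_prod_pi n (fun k y => P.qY y * P.qZgY y (zs k))]

theorem dens1 (n : ℕ) (ε : ℝ) (xs : Fin n → X) (ys : Fin n → Y) (zs : Fin n → Z)
    (h : 0 < P.wX n xs) :
    P.Wn n xs ys zs * (if (xs, ys, zs) ∈ P.T1set n ε then 1 else 0) ≤
      P.qZgYn n ys zs * Real.exp ((n : ℝ) * (P.IXZgY + ε)) := by
  have hnn : 0 ≤ P.qZgYn n ys zs * Real.exp ((n : ℝ) * (P.IXZgY + ε)) :=
    mul_nonneg (P.qZgYn_nonneg _ _ _) (Real.exp_pos _).le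
  split_ifs with hT
  · rw [mul_one]
    by_cases hW : ∃ k, P.W (xs k) (ys k) (zs k) = 0
    · obtain ⟨k, hk⟩ := hW
      have : P.Wn n xs ys zs = 0 := Finset.prod_eq_zero (Finset.mem_univ k) hk
      rw [this]; exact hnn
    · push Not at hW
      have hW' : ∀ k, 0 < P.W (xs k) (ys k) (zs k) := fun k =>
        lt_of_le_of_ne (P.W_nonneg _ _ _) (hW k).symm
      have hq : ∀ k, 0 < P.qX (xs k) := fun k =>
        lt_of_le_of_ne (P.qX_nonneg _) (Finset.prod_ne_zero_iff.1 h.ne' k (Finset.mem_univ k)).symm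
      have hg : ∀ k, 0 < P.qZgY (ys k) (zs k) := fun k =>
        lt_of_lt_of_le (mul_pos (hq k) (hW' k))
          (Finset.single_le_sum (f := fun x => P.qX x * P.W x (ys k) (zs k))
            (fun x _ => mul_nonneg (P.qX_nonneg x) (P.W_nonneg _ _ _)) (Finset.mem_univ (xs k)))
      have hT' : P.iXZgYn n xs ys zs ≤ (n : ℝ) * (P.IXZgY + ε) := hT
      have e : P.Wn n xs ys zs = P.qZgYn n ys zs * Real.exp (P.iXZgYn n xs ys zs) := by
        unfold Wn qZgYn iXZgYn iXZgY
        rw [Real.exp_sum, ← Finset.prod_mul_distrib]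
        apply Finset.prod_congr rfl; intro k _
        rw [Real.exp_log (div_pos (hW' k) (hg k))]
        have := (hg k).ne'
        field_simp
      rw [e]
      exact mul_le_mul_of_nonneg_left (Real.exp_le_exp.2 hT') (P.qZgYn_nonneg _ _ _)
  · rw [mul_zero]; exact hnn

theorem dens2 (n : ℕ) (ε : ℝ) (ys : Fin n → Y) (zs : Fin n → Z)
    (h : 0 < P.wY n ys) :
    P.qZgYn n ys zs * (if (ys, zs) ∈ P.T2set n ε then 1 else 0) ≤
      P.qZn n zs * Real.exp ((n : ℝ) * (P.IYZ + ε)) := by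
  have hnn : 0 ≤ P.qZn n zs * Real.exp ((n : ℝ) * (P.IYZ + ε)) :=
    mul_nonneg (P.qZn_nonneg _ _) (Real.exp_pos _).le
  split_ifs with hT
  · rw [mul_one]
    by_cases hW : ∃ k, P.qZgY (ys k) (zs k) = 0
    · obtain ⟨k, hk⟩ := hW
      have : P.qZgYn n ys zs = 0 := Finset.prod_eq_zero (Finset.mem_univ k) hk
      rw [this]; exact hnn
    · push Not at hW
      have hW' : ∀ k, 0 < P.qZgY (ys k) (zs k) := fun k =>
        lt_of_le_of_ne (P.qZgY_nonneg _ _) (hW k).symm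
      have hq : ∀ k, 0 < P.qY (ys k) := fun k =>
        lt_of_le_of_ne (P.qY_nonneg _) (Finset.prod_ne_zero_iff.1 h.ne' k (Finset.mem_univ k)).symm
      have hg : ∀ k, 0 < P.qZ (zs k) := fun k => by
        rw [qZ_eq]
        exact lt_of_lt_of_le (mul_pos (hq k) (hW' k))
          (Finset.single_le_sum (f := fun y => P.qY y * P.qZgY y (zs k))
            (fun y _ => mul_nonneg (P.qY_nonneg y) (P.qZgY_nonneg _ _)) (Finset.mem_univ (ys k)))
      have hT' : P.iYZn n ys zs ≤ (n : ℝ) * (P.IYZ + ε) := hT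
      have e : P.qZgYn n ys zs = P.qZn n zs * Real.exp (P.iYZn n ys zs) := by
        unfold qZgYn qZn iYZn iYZ
        rw [Real.exp_sum, ← Finset.prod_mul_distrib]
        apply Finset.prod_congr rfl; intro k _
        rw [Real.exp_log (div_pos (hW' k) (hg k))]
        have := (hg k).ne'
        field_simp
      rw [e]
      exact mul_le_mul_of_nonneg_left (Real.exp_le_exp.2 hT') (P.qZn_nonneg _ _)
  · rw [mul_zero]; exact hnn

/-- conditional atypicality probability for a codeword pair -/
def hA1 (n : ℕ) (T : Set ((Fin n → X) × (Fin n → Y) × (Fin n → Z)))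
    (xs : Fin n → X) (ys : Fin n → Y) : ℝ :=
  ∑ zs : Fin n → Z, P.Wn n xs ys zs * (if (xs, ys, zs) ∈ T then 1 else 0)

theorem hA1_nonneg (n : ℕ) (T) (xs : Fin n → X) (ys : Fin n → Y) : 0 ≤ P.hA1 n T xs ys :=
  Finset.sum_nonneg fun z _ => mul_nonneg (P.Wn_nonneg _ _ _ _) (by split_ifs <;> norm_num)

theorem hA1_le (n : ℕ) (T) (xs : Fin n → X) (ys : Fin n → Y) : P.hA1 n T xs ys ≤ 1 := by
  rw [← P.Wn_sum n xs ys]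
  apply Finset.sum_le_sum; intro z _
  have := P.Wn_nonneg n xs ys z
  split_ifs <;> linarith

theorem hA1_mean (n : ℕ) (T) :
    ∑ xs, ∑ ys, P.wX n xs * P.wY n ys * P.hA1 n T xs ys = P.jointPn n T := by
  unfold hA1 jointPn
  apply Finset.sum_congr rfl; intro xs _
  apply Finset.sum_congr rfl; intro ys _
  rw [Finset.mul_sum]
  apply Finset.sum_congr rfl; intro zs _
  unfold wX wY Wn joint
  rw [Finset.prod_mul_distrib, Finset.prod_mul_distrib, mul_assoc]
  ring

/-- two-sided version of the U-statistic bound -/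
theorem atyp (n : ℕ) (T) (δ : ℝ) (hδ : 0 ≤ δ) (hδ6 : δ ≤ 1 / 6)
    (hT : P.jointPn n T ≤ δ) (M1 M2 : ℕ) (h1 : 0 < M1) (h2 : 0 < M2) (N : ℝ)
    (hN1 : N ≤ M1) (hN2 : N ≤ M2) :
    ∑ C1 : Fin M1 → Fin n → X, ∑ C2 : Fin M2 → Fin n → Y,
      ((∏ m, P.wX n (C1 m)) * (∏ m, P.wY n (C2 m))) *
      (if ∑ i, ∑ j, P.hA1 n T (C1 i) (C2 j) > 2 * δ * (M1 * M2) then 1 else 0)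
      ≤ Real.exp (-(2 * (N * δ ^ 2))) := by
  rw [← hA1_mean] at hT
  have fin : ∀ M : ℕ, N ≤ M → Real.exp (-(M * δ / 3)) ≤ Real.exp (-(2 * (N * δ ^ 2))) := by
    intro M hM
    apply Real.exp_le_exp.2
    have a1 : N * δ ^ 2 ≤ M * δ ^ 2 := by gcongr
    have a2 : (M : ℝ) * δ ^ 2 ≤ M * δ * (1 / 6) := by
      rw [pow_two, ← mul_assoc]; gcongr
    linarith
  rcases le_total M1 M2 with h | h
  · exact (ustat (P.wX n) (P.wY n) (P.wX_nonneg n) (P.wY_nonneg n) (P.wX_sum n) (P.wY_sum n)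
      (P.hA1 n T) (P.hA1_nonneg n T) (P.hA1_le n T) δ hδ hT M1 M2 h h2).trans (fin M1 hN1)
  · rw [Finset.sum_comm] at hT
    have := (ustat (P.wY n) (P.wX n) (P.wY_nonneg n) (P.wX_nonneg n) (P.wY_sum n) (P.wX_sum n)
      (fun y x => P.hA1 n T x y) (fun y x => P.hA1_nonneg n T x y)
      (fun y x => P.hA1_le n T x y) δ hδ
      (by simpa only [mul_comm (P.wX n _) (P.wY n _)] using hT) M2 M1 h h1).trans (fin M2 hN2)
    rw [Finset.sum_comm]
    refine le_trans (le_of_eq ?_) this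
    apply Finset.sum_congr rfl; intro C2 _
    apply Finset.sum_congr rfl; intro C1 _
    rw [Finset.sum_comm, mul_comm (∏ m, P.wX n (C1 m)), mul_comm (M1:ℝ)]

theorem typ1 (n : ℕ) (ε δ : ℝ) (hδ : 0 ≤ δ) (hδ1 : δ ≤ 1) (ys : Fin n → Y) (zs : Fin n → Z)
    (M : ℕ) :
    ∑ C : Fin M → Fin n → X, (∏ m, P.wX n (C m)) *
      (if ∑ m, P.Wn n (C m) ys zs * (if (C m, ys, zs) ∈ P.T1set n ε then 1 else 0) >
        (M : ℝ) * ((1 + δ) * P.qZgYn n ys zs) then 1 else 0)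
      ≤ Real.exp (-((M : ℝ) * δ ^ 2 / (3 * Real.exp ((n : ℝ) * (P.IXZgY + ε))))) := by
  refine chernoff (P.wX n)
    (fun xs => P.Wn n xs ys zs * (if (xs, ys, zs) ∈ P.T1set n ε then 1 else 0))
    (P.wX_nonneg n) (P.wX_sum n) _ _ δ (P.qZgYn_nonneg n ys zs) (Real.exp_pos _) hδ hδ1
    (fun xs => mul_nonneg (P.Wn_nonneg _ _ _ _) (by split_ifs <;> norm_num))
    (fun xs h => P.dens1 n ε xs ys zs h) ?_ M
  rw [← wX_Wn]
  apply Finset.sum_le_sum; intro xs _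
  apply mul_le_mul_of_nonneg_left _ (P.wX_nonneg n xs)
  have := P.Wn_nonneg n xs ys zs
  split_ifs <;> linarith

theorem typ2 (n : ℕ) (ε δ : ℝ) (hδ : 0 ≤ δ) (hδ1 : δ ≤ 1) (zs : Fin n → Z)
    (M : ℕ) :
    ∑ C : Fin M → Fin n → Y, (∏ m, P.wY n (C m)) *
      (if ∑ m, P.qZgYn n (C m) zs * (if (C m, zs) ∈ P.T2set n ε then 1 else 0) >
        (M : ℝ) * ((1 + δ) * P.qZn n zs) then 1 else 0)
      ≤ Real.exp (-((M : ℝ) * δ ^ 2 / (3 * Real.exp ((n : ℝ) * (P.IYZ + ε))))) := by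
  refine chernoff (P.wY n)
    (fun ys => P.qZgYn n ys zs * (if (ys, zs) ∈ P.T2set n ε then 1 else 0))
    (P.wY_nonneg n) (P.wY_sum n) _ _ δ (P.qZn_nonneg n zs) (Real.exp_pos _) hδ hδ1
    (fun xs => mul_nonneg (P.qZgYn_nonneg _ _ _) (by split_ifs <;> norm_num))
    (fun xs h => P.dens2 n ε xs zs h) ?_ M
  rw [← wY_qZgYn]
  apply Finset.sum_le_sum; intro xs _
  apply mul_le_mul_of_nonneg_left _ (P.wY_nonneg n xs)
  have := P.qZgYn_nonneg n xs zs
  split_ifs <;> linarith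

/-- the deterministic part -/
theorem determ (n : ℕ) (δ : ℝ) (hδ : 0 ≤ δ) (M1 M2 : ℕ) (h1 : 0 < M1) (h2 : 0 < M2)
    (C1 : Fin M1 → Fin n → X) (C2 : Fin M2 → Fin n → Y)
    (T1 : Set ((Fin n → X) × (Fin n → Y) × (Fin n → Z)))
    (T2 : Set ((Fin n → Y) × (Fin n → Z)))
    (ha1 : ∑ i, ∑ j, P.hA1 n T1ᶜ (C1 i) (C2 j) ≤ 2 * δ * (M1 * M2))
    (ha2 : ∑ i, ∑ j, P.hA1 n {t | t.2 ∈ T2ᶜ} (C1 i) (C2 j) ≤ 2 * δ * (M1 * M2))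
    (hb1 : ∀ ys zs, ∑ m, P.Wn n (C1 m) ys zs * (if (C1 m, ys, zs) ∈ T1 then 1 else 0) ≤
        (M1 : ℝ) * ((1 + δ) * P.qZgYn n ys zs))
    (hb2 : ∀ zs, ∑ m, P.qZgYn n (C2 m) zs * (if (C2 m, zs) ∈ T2 then 1 else 0) ≤
        (M2 : ℝ) * ((1 + δ) * P.qZn n zs)) :
    ∑ zs, max (∑ i, ∑ j, P.Wn n (C1 i) (C2 j) zs - M1 * M2 * P.qZn n zs) 0 ≤
      (6 * δ + δ ^ 2) * (M1 * M2) := by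
  have key : ∀ zs, ∑ i, ∑ j, P.Wn n (C1 i) (C2 j) zs ≤
      (∑ i, ∑ j, P.Wn n (C1 i) (C2 j) zs * (if (C1 i, C2 j, zs) ∈ T1ᶜ then 1 else 0)) +
      (∑ i, ∑ j, P.Wn n (C1 i) (C2 j) zs * (if (C2 j, zs) ∈ T2ᶜ then 1 else 0)) +
      M1 * M2 * ((1 + δ) ^ 2 * P.qZn n zs) := by
    intro zs
    calc _ ≤ ∑ i, ∑ j, (P.Wn n (C1 i) (C2 j) zs * (if (C1 i, C2 j, zs) ∈ T1ᶜ then 1 else 0) +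
          P.Wn n (C1 i) (C2 j) zs * (if (C2 j, zs) ∈ T2ᶜ then 1 else 0) +
          P.Wn n (C1 i) (C2 j) zs * (if (C1 i, C2 j, zs) ∈ T1 then 1 else 0) *
            (if (C2 j, zs) ∈ T2 then 1 else 0)) := by
          apply Finset.sum_le_sum; intro i _
          apply Finset.sum_le_sum; intro j _
          have := P.Wn_nonneg n (C1 i) (C2 j) zs
          by_cases c1 : (C1 i, C2 j, zs) ∈ T1 <;> by_cases c2 : (C2 j, zs) ∈ T2 <;>
            simp [c1, c2, this]
      _ ≤ _ := by
          simp_rw [Finset.sum_add_distrib]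
          gcongr
          rw [Finset.sum_comm]
          calc _ ≤ ∑ j, (M1 : ℝ) * (1 + δ) *
                (P.qZgYn n (C2 j) zs * (if (C2 j, zs) ∈ T2 then 1 else 0)) := by
                apply Finset.sum_le_sum; intro j _
                rw [← Finset.sum_mul]
                have := mul_le_mul_of_nonneg_right (hb1 (C2 j) zs)
                  (show (0:ℝ) ≤ (if (C2 j, zs) ∈ T2 then 1 else 0) by split_ifs <;> norm_num)
                linarith
            _ ≤ _ := by
                rw [← Finset.mul_sum]
                have := mul_le_mul_of_nonneg_left (hb2 zs)
                  (show (0:ℝ) ≤ M1 * (1 + δ) by positivity)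
                refine this.trans (le_of_eq (by ring))
  have swap : ∀ T, ∑ i, ∑ j, P.hA1 n T (C1 i) (C2 j) = ∑ zs, ∑ i, ∑ j,
      P.Wn n (C1 i) (C2 j) zs * (if (C1 i, C2 j, zs) ∈ T then 1 else 0) := by
    intro T
    unfold hA1
    rw [Finset.sum_comm (s := Finset.univ (α := Fin n → Z))]
    apply Finset.sum_congr rfl; intro i _
    rw [Finset.sum_comm]
  have nn : ∀ (p : Prop) [Decidable p], (0:ℝ) ≤ if p then 1 else 0 := by
    intro p _; split_ifs <;> norm_num
  calc _ ≤ ∑ zs, ((∑ i, ∑ j, P.Wn n (C1 i) (C2 j) zs *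
        (if (C1 i, C2 j, zs) ∈ T1ᶜ then 1 else 0)) +
      (∑ i, ∑ j, P.Wn n (C1 i) (C2 j) zs * (if (C2 j, zs) ∈ T2ᶜ then 1 else 0)) +
      M1 * M2 * (2 * δ + δ ^ 2) * P.qZn n zs) := by
        apply Finset.sum_le_sum; intro zs _
        apply max_le
        · have := key zs
          nlinarith
        · have q := P.qZn_nonneg n zs
          have p1 : 0 ≤ ∑ i, ∑ j, P.Wn n (C1 i) (C2 j) zs *
            (if (C1 i, C2 j, zs) ∈ T1ᶜ then 1 else 0) := Finset.sum_nonneg fun i _ =>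
              Finset.sum_nonneg fun j _ => mul_nonneg (P.Wn_nonneg _ _ _ _) (nn _)
          have p2 : 0 ≤ ∑ i, ∑ j, P.Wn n (C1 i) (C2 j) zs *
            (if (C2 j, zs) ∈ T2ᶜ then 1 else 0) := Finset.sum_nonneg fun i _ =>
              Finset.sum_nonneg fun j _ => mul_nonneg (P.Wn_nonneg _ _ _ _) (nn _)
          positivity
    _ ≤ 2 * δ * (M1 * M2) + 2 * δ * (M1 * M2) + M1 * M2 * (2 * δ + δ ^ 2) := by
        rw [swap] at ha1 ha2
        rw [Finset.sum_add_distrib, Finset.sum_add_distrib, ← Finset.mul_sum, P.qZn_sum, mul_one]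
        exact add_le_add (add_le_add (by convert ha1; rfl) (by convert ha2; rfl)) le_rfl
    _ = _ := by ring

/-- total variation bounds with the unnormalised output -/
theorem tv_bounds (n : ℕ) (R1 R2 : ℝ) (M1 M2 : ℕ) (h1 : 0 < M1) (h2 : 0 < M2)
    (hN1 : Real.exp (n * R1) ≤ M1) (hN2 : Real.exp (n * R2) ≤ M2)
    (C1 : Fin M1 → Fin n → X) (C2 : Fin M2 → Fin n → Y) (ρ : ℝ)
    (hρ : ρ = (M1 / Real.exp (n * R1)) * (M2 / Real.exp (n * R2))) :
    tvDist (fun zs => P.pOut n R1 R2 C1 C2 zs) (fun zs => P.qZn n zs) ≤ (1 + ρ) / 2 ∧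
    ∀ t, ∑ zs, max (∑ i, ∑ j, P.Wn n (C1 i) (C2 j) zs - M1 * M2 * P.qZn n zs) 0 ≤ t * (M1 * M2) →
      tvDist (fun zs => P.pOut n R1 R2 C1 C2 zs) (fun zs => P.qZn n zs) ≤ t + (ρ - 1) / 2 := by
  have m1 : (0:ℝ) < M1 := by exact_mod_cast h1
  have m2 : (0:ℝ) < M2 := by exact_mod_cast h2
  have hρ1 : 1 ≤ ρ := by
    rw [hρ]
    exact one_le_mul_of_one_le_of_one_le ((one_le_div (Real.exp_pos _)).2 hN1)
      ((one_le_div (Real.exp_pos _)).2 hN2)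
  have hexp : Real.exp (-((n:ℝ) * (R1 + R2))) = ρ / (M1 * M2) := by
    rw [hρ, Real.exp_neg, mul_add, Real.exp_add]
    field_simp
  set S : (Fin n → Z) → ℝ := fun zs => ∑ i, ∑ j, P.Wn n (C1 i) (C2 j) zs with hS
  have hS0 : ∀ zs, 0 ≤ S zs := fun zs => Finset.sum_nonneg fun i _ =>
    Finset.sum_nonneg fun j _ => P.Wn_nonneg _ _ _ _
  have hSsum : ∑ zs, S zs = M1 * M2 := by
    rw [hS, Finset.sum_comm]
    have : ∀ i, ∑ zs, ∑ j, P.Wn n (C1 i) (C2 j) zs = M2 := by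
      intro i
      rw [Finset.sum_comm]
      simp [P.Wn_sum]
    simp [this]
  have hp : ∀ zs, P.pOut n R1 R2 C1 C2 zs = ρ * (S zs / (M1 * M2)) := by
    intro zs
    unfold pOut
    rw [hexp]
    ring
  have hq := P.qZn_sum n
  have hq0 := P.qZn_nonneg n
  have hp0 : ∀ zs, 0 ≤ S zs / (M1 * M2) := fun zs => div_nonneg (hS0 zs) (by positivity)
  have hps : ∑ zs, S zs / (M1 * M2) = 1 := by
    rw [← Finset.sum_div, hSsum]; field_simp
  unfold tvDist
  simp_rw [hp]
  constructor
  · have : ∑ zs, |ρ * (S zs / (M1 * M2)) - P.qZn n zs| ≤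
        ∑ zs, (ρ * (S zs / (M1 * M2)) + P.qZn n zs) := by
      apply Finset.sum_le_sum; intro zs _
      have := hp0 zs
      have := hq0 zs
      have : 0 ≤ ρ * (S zs / (M1 * M2)) := by positivity
      rw [abs_le]; constructor <;> linarith
    rw [Finset.sum_add_distrib, ← Finset.mul_sum, hps, hq] at this
    linarith
  · intro t ht
    have : ∑ zs, |ρ * (S zs / (M1 * M2)) - P.qZn n zs| ≤
        ∑ zs, ((ρ - 1) * (S zs / (M1 * M2)) +
          (2 / (M1 * M2) * max (S zs - M1 * M2 * P.qZn n zs) 0 - S zs / (M1 * M2)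
            + P.qZn n zs)) := by
      apply Finset.sum_le_sum; intro zs _
      have a := hp0 zs
      have b := hq0 zs
      have c : 0 ≤ (ρ - 1) * (S zs / (M1 * M2)) := mul_nonneg (by linarith) a
      have d : 2 / (M1 * M2 : ℝ) * max (S zs - M1 * M2 * P.qZn n zs) 0 =
          2 * max (S zs / (M1 * M2) - P.qZn n zs) 0 := by
        have : S zs - M1 * M2 * P.qZn n zs = (M1 * M2) * (S zs / (M1 * M2) - P.qZn n zs) := by
          field_simp
        rw [this, ← mul_zero ((M1:ℝ) * M2), ← mul_max_of_nonneg _ _ (by positivity)]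
        field_simp
        simp
      rw [d]
      have e1 := le_max_left (S zs / (M1 * M2) - P.qZn n zs) 0
      have e2 := le_max_right (S zs / (M1 * M2) - P.qZn n zs) 0
      rw [abs_le]; constructor <;> nlinarith
    rw [Finset.sum_add_distrib, Finset.sum_add_distrib, Finset.sum_sub_distrib,
      ← Finset.mul_sum, ← Finset.mul_sum, hps, hq] at this
    have : 2 / (M1 * M2 : ℝ) * ∑ zs, max (S zs - M1 * M2 * P.qZn n zs) 0 ≤ 2 * t := by
      calc _ ≤ 2 / (M1 * M2 : ℝ) * (t * (M1 * M2)) := by gcongr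
        _ = _ := by field_simp
    linarith

end Channel

theorem ratio_bound (N δ : ℝ) (hN : 0 < N) (hδ1 : δ ≤ 1) (hδ0 : 0 < δ)
    (ha : 0.3465 < N * δ ^ 2) :
    (⌈N⌉₊ : ℝ) / N ≤ 1 + 2.8861 * δ ^ 2 ∧ (⌈N⌉₊ : ℝ) / N ≤ 2.8861 := by
  have hinv : 1 / N ≤ 2.8861 * δ ^ 2 := by
    rw [div_le_iff₀ hN]; nlinarith
  have hc : (⌈N⌉₊ : ℝ) < N + 1 := Nat.ceil_lt_add_one hN.le
  have h2 : δ ^ 2 ≤ 1 := by nlinarith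
  constructor
  · calc (⌈N⌉₊ : ℝ) / N ≤ (N + 1) / N := by gcongr
      _ = 1 + 1 / N := by field_simp
      _ ≤ _ := by linarith
  · rcases le_total N 1 with h | h
    · have : ⌈N⌉₊ ≤ 1 := Nat.ceil_le.2 (by simpa using h)
      have : (⌈N⌉₊ : ℝ) ≤ 1 := by exact_mod_cast this
      calc (⌈N⌉₊ : ℝ) / N ≤ 1 / N := by gcongr
        _ ≤ _ := by linarith
    · rw [div_le_iff₀ hN]; linarith

theorem numeric (δ c1 c2 : ℝ) (h0 : 0 < δ) (h1 : δ ≤ 1) (a1 : 1 ≤ c1) (a2 : 1 ≤ c2)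
    (b1 : c1 ≤ 1 + 2.8861 * δ ^ 2) (b2 : c2 ≤ 1 + 2.8861 * δ ^ 2)
    (d1 : c1 ≤ 2.8861) (d2 : c2 ≤ 2.8861) :
    (δ ≤ 1 / 6 → 6 * δ + δ ^ 2 + (c1 * c2 - 1) / 2 ≤ 7 * δ) ∧
    (1 / 6 ≤ δ → (1 + c1 * c2) / 2 ≤ 7 * δ) := by
  have hm : c1 * c2 ≤ (1 + 2.8861 * δ ^ 2) * (1 + 2.8861 * δ ^ 2) := by gcongr
  have hm2 : c1 * c2 ≤ 2.8861 * 2.8861 := by gcongr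
  constructor
  · intro h
    have e1 : δ ^ 2 ≤ 1 / 6 * δ := by nlinarith
    have e2 : δ ^ 2 * δ ^ 2 ≤ 1 / 216 * δ := by
      have : δ ^ 2 ≤ 1 / 36 := by nlinarith
      nlinarith
    nlinarith
  · intro h
    rcases le_total δ (9 / 10) with h9 | h9
    · have e1 : δ ^ 2 ≤ (16 / 15) * δ - 3 / 20 := by nlinarith
      rcases le_total δ (1 / 2) with h5 | h5
      · have f1 : δ ^ 2 ≤ (2 / 3) * δ - 1 / 12 := by nlinarith
        have f2 : δ ^ 2 * δ ^ 2 ≤ 1 / 4 * ((2 / 3) * δ - 1 / 12) := by nlinarith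
        nlinarith
      · have f1 : δ ^ 2 ≤ (14 / 10) * δ - 9 / 20 := by nlinarith
        have f2 : δ ^ 2 * δ ^ 2 ≤ (53 / 50) * δ ^ 2 - 81 / 400 := by nlinarith
        nlinarith
    · linarith

theorem Channel.cbP2_wt {X Y Z : Type} [Fintype X] [Fintype Y] [Fintype Z]
    (P : Channel X Y Z) (n M1 M2 : ℕ) :
    (∑ C1 : Fin M1 → Fin n → X, ∏ m, P.wX n (C1 m)) = 1 ∧
    (∑ C2 : Fin M2 → Fin n → Y, ∏ m, P.wY n (C2 m)) = 1 := by
  constructor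
  · rw [← Fintype.sum_pow, P.wX_sum, one_pow]
  · rw [← Fintype.sum_pow, P.wY_sum, one_pow]

/-- bounds (21)-(23), putting everything together: under the atypicality
hypotheses, the variational distance exceeds `7 exp (-nβ)` with probability at most the sum
of the two doubly-exponential terms and the two union-bound terms. -/
theorem statement12 {X Y Z : Type} [Fintype X] [Fintype Y] [Fintype Z]
    (P : Channel X Y Z) (n : ℕ) (ε β R1 R2 : ℝ) (hε : 0 < ε) (hβ : 0 < β)
    (h1 : P.jointPn n ((P.T1set n ε)ᶜ) ≤ Real.exp (-((n : ℝ) * β)))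
    (h2 : P.jointPYZn n ((P.T2set n ε)ᶜ) ≤ Real.exp (-((n : ℝ) * β)))
    (hn : Real.exp (-((n : ℝ) * β)) ≤ 1) :
    P.cbP2 n (numCw n R1) (numCw n R2) (fun C1 C2 =>
        tvDist (fun zs => P.pOut n R1 R2 C1 C2 zs) (fun zs => P.qZn n zs) >
          7 * Real.exp (-((n : ℝ) * β)))
      ≤ 2 * Real.exp (-(2 * Real.exp ((n : ℝ) * (min R1 R2 - 2 * β))))
        + (Fintype.card Z : ℝ) ^ n * (Fintype.card Y : ℝ) ^ n *
            Real.exp (-(1 / 3) * Real.exp (-((n : ℝ) * (P.IXZgY + ε + 2 * β - R1))))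
        + (Fintype.card Z : ℝ) ^ n *
            Real.exp (-(1 / 3) * Real.exp (-((n : ℝ) * (P.IYZ + ε + 2 * β - R2)))) := by
  classical
  set δ := Real.exp (-((n : ℝ) * β)) with hδ
  have hδ0 : 0 < δ := Real.exp_pos _
  set M1 := numCw n R1 with hM1
  set M2 := numCw n R2 with hM2
  set N1 := Real.exp ((n : ℝ) * R1) with hN1
  set N2 := Real.exp ((n : ℝ) * R2) with hN2
  have hN1p : 0 < N1 := Real.exp_pos _
  have hN2p : 0 < N2 := Real.exp_pos _
  have hNM1 : N1 ≤ M1 := Nat.le_ceil _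
  have hNM2 : N2 ≤ M2 := Nat.le_ceil _
  have hM1p : 0 < M1 := Nat.ceil_pos.2 hN1p
  have hM2p : 0 < M2 := Nat.ceil_pos.2 hN2p
  have hW1n : ∀ C : Fin M1 → Fin n → X, 0 ≤ ∏ m, P.wX n (C m) := fun C =>
    Finset.prod_nonneg fun _ _ => P.wX_nonneg _ _
  have hW2n : ∀ C : Fin M2 → Fin n → Y, 0 ≤ ∏ m, P.wY n (C m) := fun C =>
    Finset.prod_nonneg fun _ _ => P.wY_nonneg _ _
  obtain ⟨hW1, hW2⟩ := P.cbP2_wt n M1 M2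
  have hδ2 : δ ^ 2 = Real.exp (-((n : ℝ) * (2 * β))) := by
    rw [hδ, ← Real.exp_nat_mul]; congr 1; push_cast; ring
  have hmin : Real.exp ((n : ℝ) * (min R1 R2 - 2 * β)) = min N1 N2 * δ ^ 2 := by
    have : min N1 N2 = Real.exp ((n : ℝ) * min R1 R2) := by
      rcases le_total R1 R2 with h | h
      · rw [min_eq_left h, min_eq_left]
        exact Real.exp_le_exp.2 (mul_le_mul_of_nonneg_left h (Nat.cast_nonneg n))
      · rw [min_eq_right h, min_eq_right]
        exact Real.exp_le_exp.2 (mul_le_mul_of_nonneg_left h (Nat.cast_nonneg n))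
    rw [this, hδ2, ← Real.exp_add]
    congr 1; ring
  have hexp : ∀ (I R : ℝ), Real.exp (-((n : ℝ) * (I + ε + 2 * β - R)))
      = Real.exp ((n : ℝ) * R) * δ ^ 2 / Real.exp ((n : ℝ) * (I + ε)) := by
    intro I R
    rw [hδ2, ← Real.exp_add, ← Real.exp_sub]
    congr 1; ring
  rw [hmin, hexp, hexp, ← hN1, ← hN2]
  have hX1 : ∀ I N M : ℝ, N ≤ M → Real.exp (-(M * δ ^ 2 / (3 * Real.exp ((n : ℝ) * (I + ε)))))
      ≤ Real.exp (-(1 / 3) * (N * δ ^ 2 / Real.exp ((n : ℝ) * (I + ε)))) := by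
    intro I N M hNM
    apply Real.exp_le_exp.2
    have : N * δ ^ 2 / Real.exp ((n : ℝ) * (I + ε)) ≤ M * δ ^ 2 / Real.exp ((n : ℝ) * (I + ε)) := by
      gcongr
    have e : M * δ ^ 2 / (3 * Real.exp ((n : ℝ) * (I + ε)))
        = 1 / 3 * (M * δ ^ 2 / Real.exp ((n : ℝ) * (I + ε))) := by field_simp
    rw [e]
    linarith
  by_cases hbig : 1 ≤ 2 * Real.exp (-(2 * (min N1 N2 * δ ^ 2)))
  · -- trivial regime
    have hle : P.cbP2 n M1 M2 (fun C1 C2 =>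
        tvDist (fun zs => P.pOut n R1 R2 C1 C2 zs) (fun zs => P.qZn n zs) > 7 * δ) ≤ 1 := by
      unfold Channel.cbP2
      calc _ ≤ ∑ C1 : Fin M1 → Fin n → X, ∑ C2 : Fin M2 → Fin n → Y,
            (∏ m, P.wX n (C1 m)) * (∏ m, P.wY n (C2 m)) := by
            apply Finset.sum_le_sum; intro C1 _
            apply Finset.sum_le_sum; intro C2 _
            apply mul_le_of_le_one_right (mul_nonneg (hW1n C1) (hW2n C2))
            split_ifs <;> norm_num
        _ = 1 := by
            simp_rw [← Finset.mul_sum, hW2, mul_one, hW1]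
    have p1 : 0 ≤ (Fintype.card Z : ℝ) ^ n * (Fintype.card Y : ℝ) ^ n *
        Real.exp (-(1 / 3) * (N1 * δ ^ 2 / Real.exp ((n : ℝ) * (P.IXZgY + ε)))) := by positivity
    have p2 : 0 ≤ (Fintype.card Z : ℝ) ^ n *
        Real.exp (-(1 / 3) * (N2 * δ ^ 2 / Real.exp ((n : ℝ) * (P.IYZ + ε)))) := by positivity
    linarith
  have ha : 0.3465 < min N1 N2 * δ ^ 2 := by
    by_contra hcon
    apply hbig
    push Not at hcon
    have l2 : (0.6931471803:ℝ) < Real.log 2 := Real.log_two_gt_d9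
    have : Real.exp (-Real.log 2) ≤ Real.exp (-(2 * (min N1 N2 * δ ^ 2))) := by
      apply Real.exp_le_exp.2; linarith
    rw [Real.exp_neg, Real.exp_log (by norm_num)] at this
    linarith
  have ha1 : 0.3465 < N1 * δ ^ 2 := ha.trans_le (by gcongr; exact min_le_left _ _)
  have ha2 : 0.3465 < N2 * δ ^ 2 := ha.trans_le (by gcongr; exact min_le_right _ _)
  obtain ⟨r1, s1⟩ := ratio_bound N1 δ hN1p hn hδ0 ha1
  obtain ⟨r2, s2⟩ := ratio_bound N2 δ hN2p hn hδ0 ha2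
  obtain ⟨num1, num2⟩ := numeric δ (M1 / N1) (M2 / N2) hδ0 hn ((one_le_div hN1p).2 hNM1)
    ((one_le_div hN2p).2 hNM2) r1 r2 s1 s2
  have tv := fun C1 C2 => P.tv_bounds n R1 R2 M1 M2 hM1p hM2p hNM1 hNM2 C1 C2
    ((M1 / N1) * (M2 / N2)) rfl
  rcases le_total (1 / 6) δ with h6 | h6
  · have hz : P.cbP2 n M1 M2 (fun C1 C2 =>
        tvDist (fun zs => P.pOut n R1 R2 C1 C2 zs) (fun zs => P.qZn n zs) > 7 * δ) = 0 := by
      unfold Channel.cbP2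
      apply Finset.sum_eq_zero; intro C1 _
      apply Finset.sum_eq_zero; intro C2 _
      rw [if_neg (not_lt.2 (((tv C1 C2).1).trans (num2 h6))), mul_zero]
    rw [hz]
    positivity
  · have h2' : P.jointPn n {t | t.2 ∈ (P.T2set n ε)ᶜ} ≤ δ := h2
    have hub := union_bound (ι := (Fin n → Z) × (Fin n → Y)) (κ := Fin n → Z)
      (fun C1 : Fin M1 → Fin n → X => ∏ m, P.wX n (C1 m))
      (fun C2 : Fin M2 → Fin n → Y => ∏ m, P.wY n (C2 m)) hW1n hW2n hW1 hW2
      (fun C1 C2 => if tvDist (fun zs => P.pOut n R1 R2 C1 C2 zs) (fun zs => P.qZn n zs)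
        > 7 * δ then 1 else 0)
      (fun C1 C2 => if ∑ i, ∑ j, P.hA1 n (P.T1set n ε)ᶜ (C1 i) (C2 j) > 2 * δ * (M1 * M2)
        then 1 else 0)
      (fun C1 C2 => if ∑ i, ∑ j, P.hA1 n {t | t.2 ∈ (P.T2set n ε)ᶜ} (C1 i) (C2 j)
        > 2 * δ * (M1 * M2) then 1 else 0)
      (fun p C1 => if ∑ m, P.Wn n (C1 m) p.2 p.1 *
        (if (C1 m, p.2, p.1) ∈ P.T1set n ε then 1 else 0) >
        (M1 : ℝ) * ((1 + δ) * P.qZgYn n p.2 p.1) then 1 else 0)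
      (fun zs C2 => if ∑ m, P.qZgYn n (C2 m) zs *
        (if (C2 m, zs) ∈ P.T2set n ε then 1 else 0) >
        (M2 : ℝ) * ((1 + δ) * P.qZn n zs) then 1 else 0)
      (by
        intro C1 C2
        have nn : ∀ (p : Prop) [Decidable p], (0:ℝ) ≤ if p then 1 else 0 := by
          intro p _; split_ifs <;> norm_num
        have q1 := nn (∑ i, ∑ j, P.hA1 n (P.T1set n ε)ᶜ (C1 i) (C2 j) > 2 * δ * (M1 * M2))
        have q2 := nn (∑ i, ∑ j, P.hA1 n {t | t.2 ∈ (P.T2set n ε)ᶜ} (C1 i) (C2 j)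
          > 2 * δ * (M1 * M2))
        have q3n := fun p : (Fin n → Z) × (Fin n → Y) => nn (∑ m, P.Wn n (C1 m) p.2 p.1 *
          (if (C1 m, p.2, p.1) ∈ P.T1set n ε then 1 else 0) >
          (M1 : ℝ) * ((1 + δ) * P.qZgYn n p.2 p.1))
        have q4n := fun zs => nn (∑ m, P.qZgYn n (C2 m) zs *
          (if (C2 m, zs) ∈ P.T2set n ε then 1 else 0) >
          (M2 : ℝ) * ((1 + δ) * P.qZn n zs))
        have q3 := Finset.sum_nonneg fun p (_ : p ∈ Finset.univ) => q3n p
        have q4 := Finset.sum_nonneg fun p (_ : p ∈ Finset.univ) => q4n p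
        beta_reduce
        by_cases hE : tvDist (fun zs => P.pOut n R1 R2 C1 C2 zs) (fun zs => P.qZn n zs) > 7 * δ
        · rw [if_pos hE]
          by_cases c1 : ∑ i, ∑ j, P.hA1 n (P.T1set n ε)ᶜ (C1 i) (C2 j) > 2 * δ * (M1 * M2)
          · rw [if_pos c1]; linarith
          by_cases c2 : ∑ i, ∑ j, P.hA1 n {t | t.2 ∈ (P.T2set n ε)ᶜ} (C1 i) (C2 j)
            > 2 * δ * (M1 * M2)
          · rw [if_pos c2]; linarith
          by_cases c3 : ∃ p : (Fin n → Z) × (Fin n → Y), ∑ m, P.Wn n (C1 m) p.2 p.1 *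
              (if (C1 m, p.2, p.1) ∈ P.T1set n ε then 1 else 0) >
              (M1 : ℝ) * ((1 + δ) * P.qZgYn n p.2 p.1)
          · obtain ⟨p, hp⟩ := c3
            have := Finset.single_le_sum (fun p _ => q3n p) (Finset.mem_univ p)
            rw [if_pos hp] at this
            linarith
          by_cases c4 : ∃ zs, ∑ m, P.qZgYn n (C2 m) zs *
              (if (C2 m, zs) ∈ P.T2set n ε then 1 else 0) >
              (M2 : ℝ) * ((1 + δ) * P.qZn n zs)
          · obtain ⟨p, hp⟩ := c4
            have := Finset.single_le_sum (fun p _ => q4n p) (Finset.mem_univ p)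
            rw [if_pos hp] at this
            linarith
          exfalso
          refine absurd hE (not_lt.2 (le_trans ((tv C1 C2).2 _ ?_) (num1 h6)))
          exact P.determ n δ hδ0.le M1 M2 hM1p hM2p C1 C2 (P.T1set n ε) (P.T2set n ε)
            (not_lt.1 c1) (not_lt.1 c2)
            (fun ys zs => not_lt.1 fun h => c3 ⟨(zs, ys), h⟩)
            (fun zs => not_lt.1 fun h => c4 ⟨zs, h⟩)
        · rw [if_neg hE]; linarith)
      (Real.exp (-(2 * (min N1 N2 * δ ^ 2))))
      (Real.exp (-(1 / 3) * (N1 * δ ^ 2 / Real.exp ((n : ℝ) * (P.IXZgY + ε)))))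
      (Real.exp (-(1 / 3) * (N2 * δ ^ 2 / Real.exp ((n : ℝ) * (P.IYZ + ε)))))
      (P.atyp n _ δ hδ0.le h6 h1 M1 M2 hM1p hM2p _ ((min_le_left _ _).trans hNM1)
        ((min_le_right _ _).trans hNM2))
      (P.atyp n _ δ hδ0.le h6 h2' M1 M2 hM1p hM2p _ ((min_le_left _ _).trans hNM1)
        ((min_le_right _ _).trans hNM2))
      (fun p => (P.typ1 n ε δ hδ0.le hn p.2 p.1 M1).trans (hX1 _ _ _ hNM1))
      (fun zs => (P.typ2 n ε δ hδ0.le hn zs M2).trans (hX1 _ _ _ hNM2))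
    have hc1 : (Fintype.card ((Fin n → Z) × (Fin n → Y)) : ℝ)
        = (Fintype.card Z : ℝ) ^ n * (Fintype.card Y : ℝ) ^ n := by
      simp
    have hc2 : (Fintype.card (Fin n → Z) : ℝ) = (Fintype.card Z : ℝ) ^ n := by
      simp
    rw [hc1, hc2] at hub
    refine le_trans (le_of_eq ?_) hub
    unfold Channel.cbP2
    apply Finset.sum_congr rfl; intro C1 _
    apply Finset.sum_congr rfl; intro C2 _
    congr 1

end MACResolvability
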